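/- Theorem 3.1(iii) (dual Slater condition): with the data and problems (P), (D) as in the context, suppose there exists a dual feasible (λ,S,Z) with λ_i > 0 for i = m_e+1,…,m, S lying in the interior of COP_n (as a subset of S_n), and ‖Z‖_* < 1. Then the optimal value ϑ_P of (P) (the infimum of γ over primal feasible points) equals the optimal value ϑ_D of (D) (the supremum of bᵀλ + C•Z over dual feasible points); moreover, if ϑ_D is finite, then there exists a primal feasible (X*,γ*) attaining ϑ_P = γ*; and if (λ*,S*,Z*) is a maximizer of (D), then there exists a primal feasible (X̄,γ̄) with γ̄ − bᵀλ* − C•Z* = 0. -/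

import Mathlib

open Matrix BigOperators

/-- A real symmetric matrix is completely positive if `A = V * Vᵀ` for some
entrywise nonnegative matrix `V`. -/
def IsCP {n : ℕ} (A : Matrix (Fin n) (Fin n) ℝ) : Prop :=
  ∃ (k : ℕ) (V : Matrix (Fin n) (Fin k) ℝ), (∀ i j, 0 ≤ V i j) ∧ A = V * Vᵀ

/-- A real symmetric matrix is copositive if `xᵀ B x ≥ 0` for all entrywise
nonnegative vectors `x`. -/
def IsCopositive {n : ℕ} (B : Matrix (Fin n) (Fin n) ℝ) : Prop :=
  ∀ x : Fin n → ℝ, (∀ i, 0 ≤ x i) → 0 ≤ x ⬝ᵥ (B *ᵥ x)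

/-- The dual norm of a norm `N` on the space of symmetric matrices:
`‖A‖_* = sup { A•X : X ∈ S_n, ‖X‖ ≤ 1 }`. -/
noncomputable def dualNorm {n : ℕ} (N : Matrix (Fin n) (Fin n) ℝ → ℝ)
    (A : Matrix (Fin n) (Fin n) ℝ) : ℝ :=
  sSup {r : ℝ | ∃ X : Matrix (Fin n) (Fin n) ℝ, X.IsSymm ∧ N X ≤ 1 ∧ r = (Aᵀ * X).trace}

/-- Feasibility for the primal problem (P): `A_i • X = b_i` for `i ≤ m_e`,
`A_i • X ≥ b_i` for `i > m_e`, `‖X - C‖ ≤ γ`, and `X ∈ CP_n`. -/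
def PrimalFeasible {n m : ℕ} (me : ℕ) (C : Matrix (Fin n) (Fin n) ℝ)
    (A : Fin m → Matrix (Fin n) (Fin n) ℝ) (b : Fin m → ℝ)
    (N : Matrix (Fin n) (Fin n) ℝ → ℝ)
    (X : Matrix (Fin n) (Fin n) ℝ) (γ : ℝ) : Prop :=
  X.IsSymm ∧ IsCP X ∧
  (∀ i : Fin m, (i : ℕ) < me → ((A i)ᵀ * X).trace = b i) ∧
  (∀ i : Fin m, me ≤ (i : ℕ) → ((A i)ᵀ * X).trace ≥ b i) ∧
  N (X - C) ≤ γ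

/-- Feasibility for the dual problem (D): `∑ λ_i A_i + S + Z = 0`, `λ_i ≥ 0` for
`i > m_e`, `S ∈ COP_n`, and `‖Z‖_* ≤ 1`. -/
def DualFeasible {n m : ℕ} (me : ℕ)
    (A : Fin m → Matrix (Fin n) (Fin n) ℝ)
    (N : Matrix (Fin n) (Fin n) ℝ → ℝ)
    (lam : Fin m → ℝ) (S Z : Matrix (Fin n) (Fin n) ℝ) : Prop :=
  (∑ i, lam i • A i) + S + Z = 0 ∧
  (∀ i : Fin m, me ≤ (i : ℕ) → 0 ≤ lam i) ∧
  S.IsSymm ∧ IsCopositive S ∧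
  Z.IsSymm ∧ dualNorm N Z ≤ 1

/-- The dual objective `bᵀλ + C • Z`. -/
noncomputable def dualObj {n m : ℕ} (b : Fin m → ℝ) (C : Matrix (Fin n) (Fin n) ℝ)
    (lam : Fin m → ℝ) (Z : Matrix (Fin n) (Fin n) ℝ) : ℝ :=
  (∑ i, b i * lam i) + (Cᵀ * Z).trace


/-- The trace inner product `A • X = trace (Aᵀ X)` as a bilinear map. -/
noncomputable def traceInner (n : ℕ) :
    Matrix (Fin n) (Fin n) ℝ →ₗ[ℝ] Matrix (Fin n) (Fin n) ℝ →ₗ[ℝ] ℝ :=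
  LinearMap.mk₂ ℝ (fun A X => (Aᵀ * X).trace)
    (fun A B X => by simp [Matrix.add_mul])
    (fun c A X => by simp)
    (fun A X Y => by simp [Matrix.mul_add])
    (fun c A X => by simp)

theorem traceInner_apply {n : ℕ} (A X : Matrix (Fin n) (Fin n) ℝ) :
    traceInner n A X = (Aᵀ * X).trace := rfl

theorem traceInner_eq_sum {n : ℕ} (A X : Matrix (Fin n) (Fin n) ℝ) :
    traceInner n A X = ∑ i, ∑ j, A i j * X i j := by
  simp only [traceInner_apply, Matrix.trace, Matrix.diag, Matrix.mul_apply, Matrix.transpose_apply]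
  exact Finset.sum_comm

theorem traceInner_comm {n : ℕ} (A X : Matrix (Fin n) (Fin n) ℝ) :
    traceInner n A X = traceInner n X A := by
  simp only [traceInner_eq_sum, mul_comm]

theorem traceInner_transpose {n : ℕ} (A X : Matrix (Fin n) (Fin n) ℝ) :
    traceInner n Aᵀ X = traceInner n A Xᵀ := by
  simp only [traceInner_eq_sum, Matrix.transpose_apply]
  exact Finset.sum_comm

theorem exists_eq_traceInner {n : ℕ} (g : Matrix (Fin n) (Fin n) ℝ →ₗ[ℝ] ℝ) :
    ∃ Z, ∀ X, g X = traceInner n Z X := by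
  refine ⟨Matrix.of fun i j => g (Matrix.single i j 1), fun X => ?_⟩
  conv_lhs => rw [Matrix.matrix_eq_sum_single X]
  simp only [traceInner_eq_sum, map_sum, Matrix.of_apply]
  refine Finset.sum_congr rfl fun i _ => Finset.sum_congr rfl fun j _ => ?_
  rw [show Matrix.single i j (X i j) = X i j • Matrix.single i j (1 : ℝ) by
    simp [Matrix.smul_single], map_smul, smul_eq_mul, mul_comm]

theorem dotProduct_mulVec_eq_traceInner {n : ℕ} (B : Matrix (Fin n) (Fin n) ℝ) (x : Fin n → ℝ) :
    x ⬝ᵥ (B *ᵥ x) = traceInner n B (Matrix.vecMulVec x x) := by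
  simp only [traceInner_eq_sum, dotProduct, Matrix.mulVec, Matrix.vecMulVec_apply, Finset.mul_sum]
  exact Finset.sum_congr rfl fun i _ => Finset.sum_congr rfl fun j _ => by ring

theorem isCopositive_iff_traceInner {n : ℕ} {B : Matrix (Fin n) (Fin n) ℝ} :
    IsCopositive B ↔ ∀ x : Fin n → ℝ, (∀ i, 0 ≤ x i) →
      0 ≤ traceInner n B (Matrix.vecMulVec x x) := by
  simp only [IsCopositive, dotProduct_mulVec_eq_traceInner]

namespace IsCopositive

variable {n : ℕ} {B B' : Matrix (Fin n) (Fin n) ℝ}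

theorem add (h : IsCopositive B) (h' : IsCopositive B') : IsCopositive (B + B') := by
  rw [isCopositive_iff_traceInner] at *
  intro x hx
  simpa using add_nonneg (h x hx) (h' x hx)

theorem smul (h : IsCopositive B) {c : ℝ} (hc : 0 ≤ c) : IsCopositive (c • B) := by
  rw [isCopositive_iff_traceInner] at *
  intro x hx
  simpa using mul_nonneg hc (h x hx)

theorem of_nonneg (h : ∀ i j, 0 ≤ B i j) : IsCopositive B := by
  rw [isCopositive_iff_traceInner]
  intro x hx
  rw [traceInner_eq_sum]
  exact Finset.sum_nonneg fun i _ => Finset.sum_nonneg fun j _ =>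
    mul_nonneg (h i j) (by simpa [Matrix.vecMulVec_apply] using mul_nonneg (hx i) (hx j))

theorem of_symmetrization (h : IsCopositive ((1 / 2 : ℝ) • (B + Bᵀ))) : IsCopositive B := by
  rw [isCopositive_iff_traceInner] at *
  intro x hx
  have := h x hx
  simp only [map_smul, map_add, LinearMap.smul_apply, LinearMap.add_apply, traceInner_transpose,
    Matrix.transpose_vecMulVec, smul_eq_mul] at this
  linarith

theorem traceInner_nonneg (h : IsCopositive B) {X : Matrix (Fin n) (Fin n) ℝ} (hX : IsCP X) :
    0 ≤ traceInner n B X := by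
  obtain ⟨k, V, hV, rfl⟩ := hX
  have : V * Vᵀ = ∑ l, Matrix.vecMulVec (fun i => V i l) (fun i => V i l) := by
    ext i j
    simp [Matrix.mul_apply, Matrix.sum_apply, Matrix.vecMulVec_apply]
  rw [this, map_sum]
  exact Finset.sum_nonneg fun l _ => isCopositive_iff_traceInner.1 h _ fun i => hV i l

end IsCopositive

namespace IsCP

variable {n : ℕ} {X Y : Matrix (Fin n) (Fin n) ℝ}

theorem isSymm (h : IsCP X) : X.IsSymm := by
  obtain ⟨k, V, -, rfl⟩ := h
  simp [Matrix.IsSymm]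

theorem add (hX : IsCP X) (hY : IsCP Y) : IsCP (X + Y) := by
  obtain ⟨k, V, hV, rfl⟩ := hX
  obtain ⟨l, W, hW, rfl⟩ := hY
  refine ⟨k + l, Matrix.of fun i => Fin.append (V i) (W i), fun i j => ?_, ?_⟩
  · refine Fin.addCases (fun j => ?_) (fun j => ?_) j
    · simpa using hV i j
    · simpa using hW i j
  · ext i j
    simp [Matrix.mul_apply, Fin.sum_univ_add]

theorem smul (hX : IsCP X) {c : ℝ} (hc : 0 ≤ c) : IsCP (c • X) := by
  obtain ⟨k, V, hV, rfl⟩ := hX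
  refine ⟨k, √c • V, fun i j => mul_nonneg (Real.sqrt_nonneg c) (hV i j), ?_⟩
  rw [Matrix.transpose_smul, Matrix.smul_mul, Matrix.mul_smul, smul_smul, Real.mul_self_sqrt hc]

theorem zero : IsCP (0 : Matrix (Fin n) (Fin n) ℝ) :=
  ⟨0, 0, fun _ _ => le_rfl, by simp⟩

theorem vecMulVec_self {x : Fin n → ℝ} (hx : ∀ i, 0 ≤ x i) : IsCP (Matrix.vecMulVec x x) :=
  ⟨1, Matrix.of fun i _ => x i, fun i _ => hx i, by
    ext i j; simp [Matrix.vecMulVec_apply, Matrix.mul_apply]⟩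

end IsCP

theorem convex_setOf_isCP (n : ℕ) : Convex ℝ {X : Matrix (Fin n) (Fin n) ℝ | IsCP X} :=
  fun _ hX _ hY _ _ ha hb _ => (hX.smul ha).add (hY.smul hb)

/-- In a finite-dimensional space the convex hull of a compact set is compact. -/
theorem IsCompact.convexHull_of_finiteDimensional {E : Type*} [AddCommGroup E] [Module ℝ E]
    [TopologicalSpace E] [IsTopologicalAddGroup E] [ContinuousSMul ℝ E] [FiniteDimensional ℝ E]
    {K : Set E} (hK : IsCompact K) : IsCompact (convexHull ℝ K) := by
  rcases K.eq_empty_or_nonempty with rfl | ⟨k₀, hk₀⟩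
  · simp
  set d := Module.finrank ℝ E + 1 with hd
  let F : (Fin d → ℝ) × (Fin d → E) → E := fun p => ∑ i, p.1 i • p.2 i
  have hF : Continuous F := by fun_prop
  have : convexHull ℝ K = F '' (stdSimplex ℝ (Fin d) ×ˢ Set.univ.pi fun _ => K) := by
    apply Set.Subset.antisymm
    · intro x hx
      obtain ⟨ι, _, z, w, hz, hind, hw, hw1, rfl⟩ := eq_pos_convex_span_of_mem_convexHull hx
      have hcard : Fintype.card ι ≤ Fintype.card (Fin d) := by
        rw [Fintype.card_fin]
        exact hind.card_le_finrank_succ.trans (Nat.succ_le_succ (Submodule.finrank_le _))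
      obtain ⟨e⟩ := Function.Embedding.nonempty_of_card_le hcard
      refine ⟨(Function.extend e w 0, Function.extend e z fun _ => k₀), ⟨⟨fun j => ?_, ?_⟩, ?_⟩, ?_⟩
      · by_cases h : ∃ i, e i = j
        · obtain ⟨i, rfl⟩ := h
          simpa [e.injective.extend_apply] using (hw i).le
        · simp [Function.extend_apply' _ _ _ h]
      · rw [← hw1]
        refine (Fintype.sum_of_injective e e.injective _ _ (fun j hj => ?_) fun i => ?_).symm
        · simp [Function.extend_apply' _ _ _ (by simpa using hj)]
        · simp [e.injective.extend_apply]
      · intro j _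
        by_cases h : ∃ i, e i = j
        · obtain ⟨i, rfl⟩ := h
          simpa [e.injective.extend_apply] using hz ⟨i, rfl⟩
        · simpa [Function.extend_apply' _ _ _ h] using hk₀
      · refine (Fintype.sum_of_injective e e.injective _ _ (fun j hj => ?_) fun i => ?_).symm
        · simp [Function.extend_apply' _ _ _ (by simpa using hj)]
        · simp [e.injective.extend_apply]
    · rintro _ ⟨⟨w, z⟩, ⟨⟨hw0, hw1⟩, hz⟩, rfl⟩
      exact (convex_convexHull ℝ K).sum_mem (fun i _ => hw0 i) hw1
        fun i _ => subset_convexHull ℝ K (hz i trivial)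
  rw [this]
  exact ((isCompact_stdSimplex ℝ (Fin d)).prod (isCompact_univ_pi fun _ => hK)).image hF

instance Matrix.locallyConvexSpace_real {m n : Type*} : LocallyConvexSpace ℝ (Matrix m n ℝ) :=
  inferInstanceAs (LocallyConvexSpace ℝ (m → n → ℝ))

theorem traceInner_one_vecMulVec {n : ℕ} (x : Fin n → ℝ) :
    traceInner n (Matrix.of fun _ _ => 1) (Matrix.vecMulVec x x) = (∑ i, x i) ^ 2 := by
  simp [traceInner_eq_sum, Matrix.vecMulVec_apply, sq, Finset.sum_mul_sum]

/-- The bidual of the completely positive cone is contained in the completely positive cone. -/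
theorem isCP_of_forall_isCopositive {n : ℕ} {X : Matrix (Fin n) (Fin n) ℝ}
    (h : ∀ S, IsCopositive S → 0 ≤ traceInner n S X) : IsCP X := by
  set J : Matrix (Fin n) (Fin n) ℝ := Matrix.of fun _ _ => 1 with hJ
  have hJ0 : 0 ≤ traceInner n J X := h J (.of_nonneg fun i j => by simp [hJ])
  rcases hJ0.eq_or_lt with h0 | hpos
  · have hX : X = 0 := by
      ext i j
      have hs : ∀ c : ℝ, |c| ≤ 1 → 0 ≤ c * X i j := by
        intro c hc
        have := h (c • Matrix.single i j 1 + J) (.of_nonneg fun a b => by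
          simp only [hJ, Matrix.add_apply, Matrix.smul_apply, Matrix.single_apply, Matrix.of_apply,
            smul_eq_mul]
          split_ifs
          · linarith [(abs_le.1 hc).1]
          · simp)
        rw [map_add, LinearMap.add_apply, ← h0, map_smul, LinearMap.smul_apply, add_zero,
          traceInner_eq_sum] at this
        simpa [Matrix.single_apply, ite_and] using this
      have h1 := hs 1 (by simp)
      have h2 := hs (-1) (by simp)
      simp only [Matrix.zero_apply]
      linarith
    exact hX ▸ IsCP.zero
  · let K : Set (Matrix (Fin n) (Fin n) ℝ) :=
      (fun x => Matrix.vecMulVec x x) '' stdSimplex ℝ (Fin n)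
    have hK : IsCompact K := (isCompact_stdSimplex ℝ (Fin n)).image
      (continuous_id.matrix_vecMulVec continuous_id)
    have hKC : IsCompact (convexHull ℝ K) := hK.convexHull_of_finiteDimensional
    have hKCP : convexHull ℝ K ⊆ {X | IsCP X} :=
      convexHull_min (by rintro _ ⟨x, hx, rfl⟩; exact IsCP.vecMulVec_self hx.1) (convex_setOf_isCP n)
    set s := traceInner n J X with hs
    by_cases hmem : s⁻¹ • X ∈ convexHull ℝ K
    · have := (hKCP hmem).smul hpos.le
      rwa [smul_smul, mul_inv_cancel₀ hpos.ne', one_smul] at this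
    · exfalso
      obtain ⟨f, u, hfX, hfK⟩ :=
        geometric_hahn_banach_point_closed (convex_convexHull ℝ K) hKC.isClosed hmem
      obtain ⟨T, hT⟩ := exists_eq_traceInner f.toLinearMap
      have hT' : ∀ Y, f Y = traceInner n T Y := hT
      have hcop : IsCopositive (T - u • J) := by
        rw [isCopositive_iff_traceInner]
        intro x hx
        rcases (Finset.sum_nonneg fun i _ => hx i : 0 ≤ ∑ i, x i).eq_or_lt with hx0 | hxpos
        · have : x = 0 := by
            ext i
            exact (Finset.sum_eq_zero_iff_of_nonneg fun i _ => hx i).1 hx0.symm i (Finset.mem_univ i)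
          simp [this]
        · set t := ∑ i, x i with ht
          have hy : t⁻¹ • x ∈ stdSimplex ℝ (Fin n) := by
            refine ⟨fun i => mul_nonneg (inv_nonneg.2 hxpos.le) (hx i), ?_⟩
            simp only [Pi.smul_apply, smul_eq_mul, ← Finset.mul_sum]
            exact inv_mul_cancel₀ hxpos.ne'
          have h1 := hfK _ (subset_convexHull ℝ K ⟨_, hy, rfl⟩)
          have h2 : Matrix.vecMulVec x x = t ^ 2 • Matrix.vecMulVec (t⁻¹ • x) (t⁻¹ • x) := by
            ext i j
            simp only [Matrix.vecMulVec_apply, Matrix.smul_apply, Pi.smul_apply, smul_eq_mul]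
            field_simp
          rw [hT'] at h1
          rw [map_sub, LinearMap.sub_apply, map_smul, LinearMap.smul_apply,
            traceInner_one_vecMulVec, ← ht, h2, map_smul]
          simp only [smul_eq_mul]
          nlinarith [pow_pos hxpos 2]
      have h3 := h _ hcop
      rw [hT', map_smul, smul_eq_mul, inv_mul_lt_iff₀ hpos] at hfX
      simp only [map_sub, LinearMap.sub_apply, map_smul, LinearMap.smul_apply, smul_eq_mul,
        ← hs] at h3
      linarith

/-- On a finite-dimensional real space every linear form is dominated by a multiple of any norm. -/
theorem LinearMap.exists_le_mul_of_norm_axioms {E : Type*} [AddCommGroup E] [Module ℝ E]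
    [FiniteDimensional ℝ E] {N : E → ℝ} (hN0 : ∀ x, N x = 0 ↔ x = 0)
    (hNsmul : ∀ (c : ℝ) x, N (c • x) = |c| * N x) (hNadd : ∀ x y, N (x + y) ≤ N x + N y)
    (f : E →ₗ[ℝ] ℝ) : ∃ c : ℝ, 0 ≤ c ∧ ∀ x, f x ≤ c * N x := by
  let _ : Norm E := ⟨N⟩
  have core : NormedSpace.Core ℝ E :=
    { norm_nonneg := fun x => by
        have h1 := hNadd x ((-1 : ℝ) • x)
        rw [hNsmul, neg_one_smul, add_neg_cancel, (hN0 0).2 rfl] at h1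
        simp only [abs_neg, abs_one, one_mul] at h1
        change 0 ≤ N x
        linarith
      norm_smul := hNsmul
      norm_triangle := hNadd
      norm_eq_zero_iff := hN0 }
  let _ : NormedAddCommGroup E := NormedAddCommGroup.ofCore core
  let _ : NormedSpace ℝ E := NormedSpace.ofCore core
  refine ⟨‖LinearMap.toContinuousLinearMap f‖, norm_nonneg _, fun x => ?_⟩
  exact (le_abs_self _).trans ((LinearMap.toContinuousLinearMap f).le_opNorm x)

/-- The subspace of symmetric matrices. -/
def symmetricSubmodule (n : ℕ) : Submodule ℝ (Matrix (Fin n) (Fin n) ℝ) where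
  carrier := {X | X.IsSymm}
  add_mem' := Matrix.IsSymm.add
  zero_mem' := Matrix.isSymm_zero
  smul_mem' c _ h := Matrix.IsSymm.smul h c

/-- `N` satisfies the axioms of a norm on the space of symmetric matrices. -/
structure IsNormOnSymm {n : ℕ} (N : Matrix (Fin n) (Fin n) ℝ → ℝ) : Prop where
  eq_zero_iff : ∀ X : Matrix (Fin n) (Fin n) ℝ, X.IsSymm → (N X = 0 ↔ X = 0)
  smul : ∀ (c : ℝ) (X : Matrix (Fin n) (Fin n) ℝ), X.IsSymm → N (c • X) = |c| * N X
  add_le : ∀ X Y : Matrix (Fin n) (Fin n) ℝ, X.IsSymm → Y.IsSymm → N (X + Y) ≤ N X + N Y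

namespace IsNormOnSymm

variable {n : ℕ} {N : Matrix (Fin n) (Fin n) ℝ → ℝ}

theorem zero (hN : IsNormOnSymm N) : N 0 = 0 :=
  (hN.eq_zero_iff 0 Matrix.isSymm_zero).2 rfl

theorem neg (hN : IsNormOnSymm N) {X : Matrix (Fin n) (Fin n) ℝ} (hX : X.IsSymm) :
    N (-X) = N X := by
  simpa using hN.smul (-1) X hX

theorem nonneg (hN : IsNormOnSymm N) {X : Matrix (Fin n) (Fin n) ℝ} (hX : X.IsSymm) :
    0 ≤ N X := by
  have := hN.add_le X (-X) hX hX.neg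
  rw [add_neg_cancel, hN.zero, hN.neg hX] at this
  linarith

theorem bddAbove (hN : IsNormOnSymm N) (Z : Matrix (Fin n) (Fin n) ℝ) :
    BddAbove {r : ℝ | ∃ X : Matrix (Fin n) (Fin n) ℝ, X.IsSymm ∧ N X ≤ 1 ∧
      r = (Zᵀ * X).trace} := by
  obtain ⟨c, hc, h⟩ := LinearMap.exists_le_mul_of_norm_axioms
    (E := symmetricSubmodule n) (N := fun X => N X)
    (fun X => (hN.eq_zero_iff X X.2).trans (by simp)) (fun c X => hN.smul c X X.2)
    (fun X Y => hN.add_le X Y X.2 Y.2) ((traceInner n Z).domRestrict (symmetricSubmodule n))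
  refine ⟨c, ?_⟩
  rintro _ ⟨X, hX, hX1, rfl⟩
  exact (h ⟨X, hX⟩).trans (mul_le_of_le_one_right hc hX1)

theorem dualNorm_le_one_iff (hN : IsNormOnSymm N) {Z : Matrix (Fin n) (Fin n) ℝ} :
    dualNorm N Z ≤ 1 ↔ ∀ X : Matrix (Fin n) (Fin n) ℝ, X.IsSymm → traceInner n Z X ≤ N X := by
  constructor
  · intro h X hX
    rcases (hN.nonneg hX).eq_or_lt with h0 | hpos
    · rw [← h0, (hN.eq_zero_iff X hX).1 h0.symm, map_zero]
    · have h1 : traceInner n Z ((N X)⁻¹ • X) ≤ 1 := by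
        refine (le_csSup (hN.bddAbove Z) ⟨(N X)⁻¹ • X, hX.smul _, ?_, rfl⟩).trans h
        rw [hN.smul _ _ hX, abs_of_pos (inv_pos.2 hpos), inv_mul_cancel₀ hpos.ne']
      rw [map_smul, smul_eq_mul, inv_mul_le_iff₀ hpos, mul_one] at h1
      exact h1
  · intro h
    refine csSup_le ⟨0, 0, Matrix.isSymm_zero, by simp [hN.zero], by simp⟩ ?_
    rintro _ ⟨X, hX, hX1, rfl⟩
    exact (h X hX).trans hX1

/-- The norming functional of a symmetric matrix. -/
theorem exists_dual_eq (hN : IsNormOnSymm N) {X : Matrix (Fin n) (Fin n) ℝ} (hX : X.IsSymm) :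
    ∃ Z : Matrix (Fin n) (Fin n) ℝ, Z.IsSymm ∧ dualNorm N Z ≤ 1 ∧ traceInner n Z X = N X := by
  suffices ∃ g : symmetricSubmodule n →ₗ[ℝ] ℝ, g ⟨X, hX⟩ = N X ∧ ∀ Y, g Y ≤ N Y by
    obtain ⟨g, hgX, hg⟩ := this
    obtain ⟨g', hg'⟩ := g.exists_extend
    obtain ⟨Z, hZ⟩ := exists_eq_traceInner g'
    have key : ∀ Y (hY : Y.IsSymm), traceInner n ((1 / 2 : ℝ) • (Z + Zᵀ)) Y = g ⟨Y, hY⟩ := by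
      intro Y hY
      rw [← hg', LinearMap.comp_apply, Submodule.subtype_apply, hZ]
      simp only [map_smul, map_add, LinearMap.smul_apply, LinearMap.add_apply,
        traceInner_transpose, hY.eq, smul_eq_mul]
      ring
    refine ⟨(1 / 2 : ℝ) • (Z + Zᵀ), (Matrix.isSymm_add_transpose_self Z).smul _, ?_, ?_⟩
    · rw [hN.dualNorm_le_one_iff]
      intro Y hY
      rw [key Y hY]
      exact hg _
    · rw [key X hX, hgX]
  by_cases h0 : X = 0
  · subst h0
    exact ⟨0, by simp [hN.zero], fun Y => by simpa using hN.nonneg Y.2⟩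
  · have hx : (⟨X, hX⟩ : symmetricSubmodule n) ≠ 0 := fun h => h0 (congrArg Subtype.val h)
    obtain ⟨g, hg1, hg2⟩ := exists_extension_of_le_sublinear
      (LinearPMap.mkSpanSingleton (σ := RingHom.id ℝ) (⟨X, hX⟩ : symmetricSubmodule n) (N X) hx)
      (fun Y => N Y) (fun c hc Y => by simpa [abs_of_pos hc] using hN.smul c Y Y.2)
      (fun Y W => hN.add_le Y W Y.2 W.2) (by
        rintro ⟨y, hy⟩
        obtain ⟨c, rfl⟩ := Submodule.mem_span_singleton.1 hy
        rw [LinearPMap.mkSpanSingleton'_apply]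
        have := hN.smul c X hX
        simp only [RingHom.id_apply, smul_eq_mul, Submodule.coe_smul, this]
        exact mul_le_mul_of_nonneg_right (le_abs_self c) (hN.nonneg hX))
    refine ⟨g, ?_, hg2⟩
    rw [← LinearPMap.mkSpanSingleton_apply ℝ ℝ (σ := RingHom.id ℝ) hx (N X)]
    exact hg1 ⟨_, Submodule.mem_span_singleton_self _⟩

end IsNormOnSymm

/-- An interior point of the copositive cone, relative to the symmetric matrices, is interior to
the set of all matrices with copositive quadratic form. -/
theorem mem_interior_setOf_isCopositive {n : ℕ} {S : Matrix (Fin n) (Fin n) ℝ} (hS : S.IsSymm)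
    (h : (⟨S, hS⟩ : {M : Matrix (Fin n) (Fin n) ℝ // M.IsSymm}) ∈
      interior {p : {M : Matrix (Fin n) (Fin n) ℝ // M.IsSymm} | IsCopositive p.1}) :
    S ∈ interior {M : Matrix (Fin n) (Fin n) ℝ | IsCopositive M} := by
  let φ : Matrix (Fin n) (Fin n) ℝ → {M : Matrix (Fin n) (Fin n) ℝ // M.IsSymm} := fun M =>
    ⟨(1 / 2 : ℝ) • (M + Mᵀ), (Matrix.isSymm_add_transpose_self M).smul _⟩
  have hφ : Continuous φ := by
    refine Continuous.subtype_mk ?_ _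
    exact (continuous_id.add continuous_id.matrix_transpose).const_smul (1 / 2 : ℝ)
  have hφS : φ S = ⟨S, hS⟩ := by
    refine Subtype.ext ?_
    change (1 / 2 : ℝ) • (S + Sᵀ) = S
    rw [hS.eq, ← two_smul ℝ S, smul_smul]
    norm_num
  refine mem_interior.2 ⟨φ ⁻¹' interior {p | IsCopositive p.1}, fun M hM => ?_,
    isOpen_interior.preimage hφ, ?_⟩
  · exact IsCopositive.of_symmetrization (interior_subset hM)
  · rw [Set.mem_preimage, hφS]
    exact h

section Duality

variable {n m me : ℕ} {C : Matrix (Fin n) (Fin n) ℝ} {A : Fin m → Matrix (Fin n) (Fin n) ℝ}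
  {b : Fin m → ℝ} {N : Matrix (Fin n) (Fin n) ℝ → ℝ}

theorem dualObj_le_of_feasible (hN : IsNormOnSymm N) (hC : C.IsSymm)
    {X : Matrix (Fin n) (Fin n) ℝ} {γ : ℝ} (hP : PrimalFeasible me C A b N X γ)
    {lam : Fin m → ℝ} {S Z : Matrix (Fin n) (Fin n) ℝ} (hD : DualFeasible me A N lam S Z) :
    dualObj b C lam Z ≤ γ := by
  obtain ⟨hXs, hXcp, heq, hge, hXN⟩ := hP
  obtain ⟨hsum, hlam, -, hScop, -, hZN⟩ := hD
  have h1 : ∑ i, b i * lam i ≤ ∑ i, lam i * traceInner n (A i) X := by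
    refine Finset.sum_le_sum fun i _ => ?_
    rcases lt_or_ge (i : ℕ) me with hi | hi
    · rw [← heq i hi, mul_comm, traceInner_apply]
    · rw [mul_comm]
      exact mul_le_mul_of_nonneg_left (hge i hi) (hlam i hi)
  have h2 : ∑ i, lam i * traceInner n (A i) X + traceInner n S X + traceInner n Z X = 0 := by
    have := congrArg (fun M => traceInner n M X) hsum
    simpa [LinearMap.sum_apply] using this
  have h3 := hScop.traceInner_nonneg hXcp
  have h4 := hN.dualNorm_le_one_iff.1 hZN (C - X) (hC.sub hXs)
  rw [← neg_sub X C, hN.neg (hXs.sub hC), neg_sub, map_sub] at h4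
  have h5 : dualObj b C lam Z = ∑ i, b i * lam i + traceInner n Z C := by
    rw [traceInner_comm]; rfl
  linarith

theorem nonpos_of_forall_mul_le {a v : ℝ} (h : ∀ c : ℝ, 0 ≤ c → c * a ≤ v) : a ≤ 0 := by
  by_contra! ha
  have := h ((|v| + 1) / a) (by positivity)
  rw [div_mul_cancel₀ _ ha.ne'] at this
  linarith [le_abs_self v]

/-- Under the dual Slater condition, an upper bound `v` for the dual values admits a Lagrange
multiplier for the constraint `∑ λᵢ Aᵢ + S + Z = 0`. -/
theorem exists_lagrange_multiplier (hN : IsNormOnSymm N) (hA : ∀ i, (A i).IsSymm)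
    {lamt : Fin m → ℝ} {St Zt : Matrix (Fin n) (Fin n) ℝ} (hDt : DualFeasible me A N lamt St Zt)
    (hSt : St ∈ interior {M : Matrix (Fin n) (Fin n) ℝ | IsCopositive M}) {v : ℝ}
    (hv : ∀ lam S Z, DualFeasible me A N lam S Z → dualObj b C lam Z ≤ v) :
    ∃ X : Matrix (Fin n) (Fin n) ℝ, ∀ (lam : Fin m → ℝ) (S Z : Matrix (Fin n) (Fin n) ℝ),
      (∀ i : Fin m, me ≤ (i : ℕ) → 0 ≤ lam i) → IsCopositive S → Z.IsSymm → dualNorm N Z ≤ 1 →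
      dualObj b C lam Z -
        (∑ i, lam i * traceInner n (A i) X + traceInner n S X + traceInner n Z X) ≤ v := by
  let W : Set (ℝ × Matrix (Fin n) (Fin n) ℝ) := {p | ∃ (lam : Fin m → ℝ)
    (Z : Matrix (Fin n) (Fin n) ℝ), (∀ i : Fin m, me ≤ (i : ℕ) → 0 ≤ lam i) ∧ Z.IsSymm ∧
    dualNorm N Z ≤ 1 ∧ p.1 < dualObj b C lam Z ∧ IsCopositive (-(∑ i, lam i • A i) - Z - p.2)}
  have hWconv : Convex ℝ W := by
    rintro ⟨t, U⟩ ⟨lam, Z, hlam, hZs, hZ, ht, hU⟩ ⟨t', U'⟩ ⟨lam', Z', hlam', hZs', hZ', ht', hU'⟩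
      α β hα hβ hαβ
    refine ⟨α • lam + β • lam', α • Z + β • Z', fun i hi => ?_, (hZs.smul α).add (hZs'.smul β),
      ?_, ?_, ?_⟩
    · exact add_nonneg (mul_nonneg hα (hlam i hi)) (mul_nonneg hβ (hlam' i hi))
    · rw [hN.dualNorm_le_one_iff] at hZ hZ' ⊢
      intro Y hY
      simp only [map_add, map_smul, LinearMap.add_apply, LinearMap.smul_apply, smul_eq_mul]
      calc _ ≤ α * N Y + β * N Y := add_le_add (mul_le_mul_of_nonneg_left (hZ Y hY) hα)
            (mul_le_mul_of_nonneg_left (hZ' Y hY) hβ)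
        _ = N Y := by rw [← add_mul, hαβ, one_mul]
    · have : dualObj b C (α • lam + β • lam') (α • Z + β • Z')
          = α * dualObj b C lam Z + β * dualObj b C lam' Z' := by
        have hs : ∑ i, b i * (α • lam + β • lam') i
            = α * ∑ i, b i * lam i + β * ∑ i, b i * lam' i := by
          rw [Finset.mul_sum, Finset.mul_sum, ← Finset.sum_add_distrib]
          exact Finset.sum_congr rfl fun i _ => by
            simp only [Pi.add_apply, Pi.smul_apply, smul_eq_mul]; ring
        simp only [dualObj, hs, Matrix.mul_add, Matrix.mul_smul, Matrix.trace_add,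
          Matrix.trace_smul, smul_eq_mul]
        ring
      rw [this]
      rcases hα.eq_or_lt with rfl | hα
      · obtain rfl : β = 1 := by simpa using hαβ
        simpa using ht'
      · exact add_lt_add_of_lt_of_le (mul_lt_mul_of_pos_left ht hα)
          (mul_le_mul_of_nonneg_left ht'.le hβ)
    · have : -(∑ i, (α • lam + β • lam') i • A i) - (α • Z + β • Z') - (α • U + β • U')
          = α • (-(∑ i, lam i • A i) - Z - U) + β • (-(∑ i, lam' i • A i) - Z' - U') := by
        have hs : ∑ i, (α • lam + β • lam') i • A i
            = α • ∑ i, lam i • A i + β • ∑ i, lam' i • A i := by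
          rw [Finset.smul_sum, Finset.smul_sum, ← Finset.sum_add_distrib]
          exact Finset.sum_congr rfl fun i _ => by
            simp only [Pi.add_apply, Pi.smul_apply, smul_eq_mul, add_smul, mul_smul]
        rw [hs]
        module
      exact this ▸ (hU.smul hα).add (hU'.smul hβ)
  have hWint : (dualObj b C lamt Zt - 1, (0 : Matrix (Fin n) (Fin n) ℝ)) ∈ interior W := by
    obtain ⟨hsum, hlam, -, -, hZs, hZ⟩ := hDt
    refine mem_interior.2 ⟨{p | p.1 < dualObj b C lamt Zt} ∩
      (fun p => St - p.2) ⁻¹' interior {M : Matrix (Fin n) (Fin n) ℝ | IsCopositive M},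
      ?_, ?_, ?_⟩
    · rintro ⟨t, U⟩ ⟨ht, hU⟩
      refine ⟨lamt, Zt, hlam, hZs, hZ, ht, ?_⟩
      have : -(∑ i, lamt i • A i) - Zt = St := by
        rw [← sub_eq_zero, ← neg_eq_zero, ← hsum]; abel
      rw [this]
      exact interior_subset (s := {M : Matrix (Fin n) (Fin n) ℝ | IsCopositive M}) hU
    · exact (isOpen_lt continuous_fst continuous_const).inter
        (isOpen_interior.preimage (continuous_const.sub continuous_snd))
    · refine ⟨?_, ?_⟩
      · simp
      · simpa using hSt
  have hvW : (v, (0 : Matrix (Fin n) (Fin n) ℝ)) ∉ interior W := by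
    intro h
    obtain ⟨lam, Z, hlam, hZs, hZ, ht, hU⟩ := interior_subset h
    refine absurd (hv lam (-(∑ i, lam i • A i) - Z) Z
      ⟨by abel, hlam, ?_, by simpa using hU, hZs, hZ⟩) (not_le.2 ht)
    exact (((symmetricSubmodule n).sum_mem fun i _ =>
      (symmetricSubmodule n).smul_mem (lam i) (hA i) :
        ∑ i, lam i • A i ∈ symmetricSubmodule n) : Matrix.IsSymm _).neg.sub hZs
  obtain ⟨f, hf⟩ := geometric_hahn_banach_open_point hWconv.interior isOpen_interior hvW
  have hfW : ∀ p ∈ W, f p ≤ f (v, 0) := by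
    intro p hp
    have hcl : closure (interior W) ⊆ {p | f p ≤ f (v, 0)} :=
      closure_minimal (fun q hq => (hf q hq).le) (isClosed_le f.continuous continuous_const)
    apply hcl
    rw [hWconv.closure_interior_eq_closure_of_nonempty_interior ⟨_, hWint⟩]
    exact subset_closure hp
  set τ := f (1, 0) with hτ
  obtain ⟨G, hG⟩ := exists_eq_traceInner (f.toLinearMap.comp (LinearMap.inr ℝ ℝ _))
  have hfapp : ∀ (t : ℝ) (U : Matrix (Fin n) (Fin n) ℝ), f (t, U) = t * τ + traceInner n G U := by
    intro t U
    have h1 : (t, U) = t • ((1 : ℝ), (0 : Matrix (Fin n) (Fin n) ℝ)) + (0, U) := by simp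
    have h2 : f (0, U) = traceInner n G U := hG U
    rw [h1, map_add, map_smul, h2, smul_eq_mul]
  have hτpos : 0 < τ := by
    have h1 := hf _ hWint
    rw [hfapp, hfapp, map_zero, add_zero, add_zero] at h1
    have h2 := hv _ _ _ hDt
    by_contra! h
    nlinarith
  refine ⟨τ⁻¹ • G, fun lam S Z hlam hS hZs hZ => ?_⟩
  set R := ∑ i, lam i * traceInner n (A i) (τ⁻¹ • G) + traceInner n S (τ⁻¹ • G)
    + traceInner n Z (τ⁻¹ • G) with hR
  have hRG : traceInner n G (-(∑ i, lam i • A i) - Z - S) = - (τ * R) := by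
    rw [hR, traceInner_comm]
    simp only [map_sub, map_neg, map_sum, map_smul, LinearMap.sub_apply, LinearMap.neg_apply,
      LinearMap.sum_apply, LinearMap.smul_apply, smul_eq_mul, mul_add, Finset.mul_sum]
    have : ∀ a : ℝ, τ * (τ⁻¹ * a) = a := fun a => mul_inv_cancel_left₀ hτpos.ne' a
    simp only [this, mul_left_comm τ]
    ring
  refine le_of_forall_lt_imp_le_of_dense fun t ht => ?_
  have h1 := hfW (t + R, -(∑ i, lam i • A i) - Z - S)
    ⟨lam, Z, hlam, hZs, hZ, by simp only; linarith, by simpa using hS⟩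
  rw [hfapp, hfapp, hRG, map_zero] at h1
  exact le_of_mul_le_mul_right (by linarith) hτpos

/-- Under the dual Slater condition, every upper bound `v` for the dual values is a primal feasible
objective value. -/
theorem exists_primalFeasible_of_dual_bound (hN : IsNormOnSymm N) (hC : C.IsSymm)
    (hA : ∀ i, (A i).IsSymm) {lamt : Fin m → ℝ} {St Zt : Matrix (Fin n) (Fin n) ℝ}
    (hDt : DualFeasible me A N lamt St Zt)
    (hSt : St ∈ interior {M : Matrix (Fin n) (Fin n) ℝ | IsCopositive M}) {v : ℝ}
    (hv : ∀ lam S Z, DualFeasible me A N lam S Z → dualObj b C lam Z ≤ v) :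
    ∃ X, PrimalFeasible me C A b N X v := by
  obtain ⟨X, hX⟩ := exists_lagrange_multiplier (C := C) (b := b) hN hA hDt hSt hv
  have hS0 : IsCopositive (0 : Matrix (Fin n) (Fin n) ℝ) := .of_nonneg fun _ _ => le_rfl
  have hZ0 : dualNorm N 0 ≤ 1 :=
    hN.dualNorm_le_one_iff.2 fun Y hY => by simpa using hN.nonneg hY
  have hcp : IsCP X := isCP_of_forall_isCopositive fun S hS => by
    have := nonpos_of_forall_mul_le (a := -traceInner n S X) (v := v) fun c hc => by
      simpa [dualObj] using hX 0 (c • S) 0 (fun _ _ => le_rfl) (hS.smul hc) Matrix.isSymm_zero hZ0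
    linarith
  have hlam : ∀ (i : Fin m) (c : ℝ), (me ≤ (i : ℕ) → 0 ≤ c) →
      c * (b i - traceInner n (A i) X) ≤ v := by
    intro i c hc
    have := hX (Pi.single i c) 0 0 (fun j hj => by
      rcases eq_or_ne j i with rfl | hji
      · simpa using hc hj
      · simp [hji]) hS0 Matrix.isSymm_zero hZ0
    simp only [dualObj, Pi.single_apply, mul_ite, mul_zero, ite_mul, zero_mul, map_zero,
      LinearMap.zero_apply, add_zero, Matrix.trace_zero, Finset.sum_ite_eq', Finset.mem_univ,
      if_true] at this
    linarith
  have hge : ∀ i, b i ≤ traceInner n (A i) X := fun i =>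
    sub_nonpos.1 (nonpos_of_forall_mul_le fun c hc => hlam i c fun _ => hc)
  refine ⟨X, hcp.isSymm, hcp, fun i hi => ?_, fun i _ => hge i, ?_⟩
  · refine le_antisymm ?_ (hge i)
    have := nonpos_of_forall_mul_le (a := traceInner n (A i) X - b i) (v := v) fun c _ => by
      linarith [hlam i (-c) fun h => absurd hi (not_lt.2 h)]
    simpa [traceInner_apply] using this
  · obtain ⟨Z, hZs, hZ, hZX⟩ := hN.exists_dual_eq (hC.sub hcp.isSymm)
    have := hX 0 0 Z (fun _ _ => le_rfl) hS0 hZs hZ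
    rw [← neg_sub C X, hN.neg (hC.sub hcp.isSymm), ← hZX, map_sub, traceInner_comm Z C]
    simpa [dualObj, traceInner_apply] using this

end Duality

theorem dual_slater_strong_duality (n m me : ℕ) (hn : 1 ≤ n) (hme : me ≤ m)
    (C : Matrix (Fin n) (Fin n) ℝ) (hC : C.IsSymm)
    (A : Fin m → Matrix (Fin n) (Fin n) ℝ) (hA : ∀ i, (A i).IsSymm)
    (b : Fin m → ℝ)
    (N : Matrix (Fin n) (Fin n) ℝ → ℝ)
    -- `N` is a norm on the space `S_n` of symmetric matrices:
    (hN0 : ∀ X : Matrix (Fin n) (Fin n) ℝ, X.IsSymm → (N X = 0 ↔ X = 0))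
    (hNsmul : ∀ (c : ℝ) (X : Matrix (Fin n) (Fin n) ℝ), X.IsSymm → N (c • X) = |c| * N X)
    (hNadd : ∀ X Y : Matrix (Fin n) (Fin n) ℝ, X.IsSymm → Y.IsSymm →
      N (X + Y) ≤ N X + N Y)
    -- the dual Slater point:
    (lamt : Fin m → ℝ) (St Zt : Matrix (Fin n) (Fin n) ℝ)
    (hDt : DualFeasible me A N lamt St Zt)
    (hlamt : ∀ i : Fin m, me ≤ (i : ℕ) → 0 < lamt i)
    (hStsymm : St.IsSymm)
    (hStint : (⟨St, hStsymm⟩ : {M : Matrix (Fin n) (Fin n) ℝ // M.IsSymm}) ∈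
      interior {p : {M : Matrix (Fin n) (Fin n) ℝ // M.IsSymm} | IsCopositive p.1})
    (hZt : dualNorm N Zt < 1) :
    -- strong duality: ϑ_P = ϑ_D
    sInf {γ : ℝ | ∃ X : Matrix (Fin n) (Fin n) ℝ, PrimalFeasible me C A b N X γ}
      = sSup {v : ℝ | ∃ (lam : Fin m → ℝ) (S Z : Matrix (Fin n) (Fin n) ℝ),
          DualFeasible me A N lam S Z ∧ v = dualObj b C lam Z} ∧
    -- primal attainment, provided ϑ_D is finite (the dual value set is bounded above):
    (BddAbove {v : ℝ | ∃ (lam : Fin m → ℝ) (S Z : Matrix (Fin n) (Fin n) ℝ),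
          DualFeasible me A N lam S Z ∧ v = dualObj b C lam Z} →
      ∃ (Xs : Matrix (Fin n) (Fin n) ℝ) (γs : ℝ),
        PrimalFeasible me C A b N Xs γs ∧
        γs = sInf {γ : ℝ | ∃ X : Matrix (Fin n) (Fin n) ℝ,
          PrimalFeasible me C A b N X γ}) ∧
    -- zero gap at any dual maximizer:
    (∀ (lams : Fin m → ℝ) (Ss Zs : Matrix (Fin n) (Fin n) ℝ),
      DualFeasible me A N lams Ss Zs →
      (∀ (lam : Fin m → ℝ) (S Z : Matrix (Fin n) (Fin n) ℝ),
          DualFeasible me A N lam S Z → dualObj b C lam Z ≤ dualObj b C lams Zs) →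
      ∃ (Xb : Matrix (Fin n) (Fin n) ℝ) (γb : ℝ),
        PrimalFeasible me C A b N Xb γb ∧ γb - dualObj b C lams Zs = 0) := by
  have hN : IsNormOnSymm N := ⟨hN0, hNsmul, hNadd⟩
  have hSt := mem_interior_setOf_isCopositive hStsymm hStint
  set P := {γ : ℝ | ∃ X : Matrix (Fin n) (Fin n) ℝ, PrimalFeasible me C A b N X γ} with hP
  set D := {v : ℝ | ∃ (lam : Fin m → ℝ) (S Z : Matrix (Fin n) (Fin n) ℝ),
    DualFeasible me A N lam S Z ∧ v = dualObj b C lam Z} with hD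
  have hDne : D.Nonempty := ⟨_, lamt, St, Zt, hDt, rfl⟩
  have hweak : ∀ γ ∈ P, ∀ v ∈ D, v ≤ γ := by
    rintro γ ⟨X, hX⟩ v ⟨lam, S, Z, hF, rfl⟩
    exact dualObj_le_of_feasible hN hC hX hF
  have hstrong : ∀ v, (∀ w ∈ D, w ≤ v) → v ∈ P := fun v hv =>
    exists_primalFeasible_of_dual_bound hN hC hA hDt hSt fun lam S Z hF =>
      hv _ ⟨lam, S, Z, hF, rfl⟩
  have hleast : BddAbove D → IsLeast P (sSup D) := fun hbdd =>
    ⟨hstrong _ fun w hw => le_csSup hbdd hw, fun γ hγ => csSup_le hDne (hweak γ hγ)⟩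
  refine ⟨?_, fun hbdd => ?_, fun lams Ss Zs hF hmax => ?_⟩
  · by_cases hbdd : BddAbove D
    · exact (hleast hbdd).csInf_eq
    · have hPe : P = ∅ := Set.eq_empty_of_forall_notMem fun γ hγ => hbdd ⟨γ, hweak γ hγ⟩
      rw [Real.sSup_of_not_bddAbove hbdd, hPe, Real.sInf_empty]
  · obtain ⟨X, hX⟩ := (hleast hbdd).1
    exact ⟨X, sSup D, hX, (hleast hbdd).csInf_eq.symm⟩
  · obtain ⟨X, hX⟩ := hstrong (dualObj b C lams Zs) (by
      rintro _ ⟨lam, S, Z, hF', rfl⟩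
      exact hmax lam S Z hF')
    exact ⟨X, _, hX, sub_self _⟩
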